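/- arXiv:2512.19939 — 7 statements merged into one kernel-verified Lean document; each statement's English description precedes it below -/
import Mathlib

section
/- Let G be a finite simple graph that is acyclic (a forest). Then the rank over 𝔽₂ of the adjacency matrix of G equals twice the vertex cover number of G; that is, rank₂(G) = 2·β(G). -/
open Classical in
/-- The adjacency matrix of `G` over `ZMod 2`. -/
noncomputable def adjMat2 {V : Type*} [Fintype V] (G : SimpleGraph V) :
    Matrix V V (ZMod 2) :=
  Matrix.of fun u v => if G.Adj u v then 1 else 0

/-- `rank₂(G)`, the rank over `𝔽₂` of the adjacency matrix of `G`. -/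
noncomputable def rank2 {V : Type*} [Fintype V] (G : SimpleGraph V) : ℕ :=
  (adjMat2 G).rank

/-- A vertex cover: a set of vertices containing an endpoint of every edge. -/
def IsVertexCover {V : Type*} (G : SimpleGraph V) (A : Finset V) : Prop :=
  ∀ ⦃u v : V⦄, G.Adj u v → u ∈ A ∨ v ∈ A

/-- `β(G)`, the minimum cardinality of a vertex cover of `G`. -/
noncomputable def vertexCoverNumber {V : Type*} [Fintype V] (G : SimpleGraph V) : ℕ :=
  sInf {n | ∃ A : Finset V, IsVertexCover G A ∧ A.card = n}

theorem exists_leaf {V : Type*} [Fintype V] (G : SimpleGraph V) (hG : G.IsAcyclic)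
    (hne : G ≠ ⊥) : ∃ v u, G.Adj v u ∧ ∀ w, G.Adj v w → w = u := by
  classical
  obtain ⟨a, b, hab⟩ := SimpleGraph.ne_bot_iff_exists_adj.mp hne
  haveI : Nonempty V := ⟨a⟩
  obtain ⟨u, v, p, hp, hmax⟩ := SimpleGraph.Walk.exists_isPath_forall_isPath_length_le_length G
  have h1 : 1 ≤ p.length := by
    have := hmax a b hab.toWalk (by simp [SimpleGraph.Walk.isPath_def, hab.ne])
    simpa using this
  have hnil : ¬p.Nil := by
    intro h
    rw [SimpleGraph.Walk.nil_iff_length_eq] at h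
    omega
  refine ⟨u, _, p.adj_snd hnil, fun w hadj ↦ ?_⟩
  apply hG.eq_snd_of_adj_start hp hadj
  by_contra hw
  have := hmax _ _ (p.cons hadj.symm) (hp.cons hw)
  simp at this

theorem cover_step {V : Type*} [Fintype V] (G : SimpleGraph V) (v u : V)
    (hvu : G.Adj v u) (huniq : ∀ w, G.Adj v w → w = u) :
    vertexCoverNumber G = vertexCoverNumber (G.deleteIncidenceSet u) + 1 := by
  classical
  have hmem : ∀ H : SimpleGraph V, ∃ A : Finset V, IsVertexCover H A ∧
      A.card = vertexCoverNumber H := fun H =>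
    Nat.sInf_mem (s := {n | ∃ A : Finset V, IsVertexCover H A ∧ A.card = n})
      ⟨_, Finset.univ, fun _ _ _ => Or.inl (Finset.mem_univ _), rfl⟩
  have hle : ∀ (H : SimpleGraph V) (A : Finset V), IsVertexCover H A →
      vertexCoverNumber H ≤ A.card := fun H A hA => Nat.sInf_le ⟨A, hA, rfl⟩
  apply le_antisymm
  · obtain ⟨A, hA, hc⟩ := hmem (G.deleteIncidenceSet u)
    rw [← hc]
    refine (hle G (insert u A) ?_).trans (Finset.card_insert_le _ _)
    intro a b hab
    by_cases ha : a = u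
    · simp [ha]
    by_cases hb : b = u
    · simp [hb]
    have := hA (SimpleGraph.deleteIncidenceSet_adj.mpr ⟨hab, ha, hb⟩)
    simp only [Finset.mem_insert]
    tauto
  · obtain ⟨A, hA, hc⟩ := hmem G
    rw [← hc]
    have h1 : IsVertexCover (G.deleteIncidenceSet u) (A \ {u, v}) := by
      intro a b hab
      obtain ⟨hab, ha, hb⟩ := SimpleGraph.deleteIncidenceSet_adj.mp hab
      have hav : a ≠ v := by rintro rfl; exact hb (huniq _ hab)
      have hbv : b ≠ v := by rintro rfl; exact ha (huniq _ hab.symm)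
      have := hA hab
      simp [ha, hb, hav, hbv, this]
    have h2 : (A \ {u, v}).card < A.card := by
      apply Finset.card_lt_card
      refine ⟨Finset.sdiff_subset, fun h => ?_⟩
      rcases hA hvu with h' | h' <;> simpa using h h'
    have := hle _ _ h1
    omega

theorem rank_step {V : Type*} [Fintype V] (G : SimpleGraph V) (v u : V)
    (hvu : G.Adj v u) (huniq : ∀ w, G.Adj v w → w = u) :
    rank2 G = rank2 (G.deleteIncidenceSet u) + 2 := by
  classical
  set A := adjMat2 G with hA
  set B := adjMat2 (G.deleteIncidenceSet u) with hB
  have hAe : ∀ a b, A a b = if G.Adj a b then 1 else 0 := fun a b => by simp [hA, adjMat2]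
  have hBe : ∀ a b, B a b = if G.Adj a b ∧ a ≠ u ∧ b ≠ u then 1 else 0 := fun a b => by
    simp [hB, adjMat2, SimpleGraph.deleteIncidenceSet_adj]
  have hBu : ∀ x, B.mulVec x u = 0 := fun x => by
    simp [Matrix.mulVec, dotProduct, hBe]
  have hmv : ∀ x a, a ≠ u → A.mulVec x a = B.mulVec x a + A a u * x u := by
    intro x a ha
    have : ∀ b, A a b * x b = B a b * x b + if b = u then A a u * x u else 0 := by
      intro b
      by_cases hb : b = u
      · subst hb; simp [hBe]
      · simp [hAe, hBe, ha, hb]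
    simp only [Matrix.mulVec, dotProduct]
    rw [Finset.sum_congr rfl fun b _ => this b, Finset.sum_add_distrib]
    simp
  have hAv : ∀ x, A.mulVec x v = x u := by
    intro x
    have : ∀ b, A v b = if b = u then 1 else 0 := by
      intro b
      rw [hAe]
      have : G.Adj v b ↔ b = u := ⟨huniq b, by rintro rfl; exact hvu⟩
      simp [this]
    simp [Matrix.mulVec, dotProduct, this]
  let L : (V → ZMod 2) →ₗ[ZMod 2] (ZMod 2 × ZMod 2) :=
    (LinearMap.proj u).prod ((LinearMap.proj u).comp A.mulVecLin)
  have hL : ∀ x, L x = (x u, A.mulVec x u) := fun x => rfl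
  let K := LinearMap.ker B.mulVecLin
  have hker : LinearMap.ker A.mulVecLin = K ⊓ LinearMap.ker L := by
    ext x
    simp only [K, Submodule.mem_inf, LinearMap.mem_ker, Matrix.mulVecLin_apply, hL,
      Prod.mk_eq_zero]
    constructor
    · intro h
      have hu : x u = 0 := by rw [← hAv x, h]; rfl
      refine ⟨?_, hu, by rw [h]; rfl⟩
      ext a
      by_cases ha : a = u
      · subst ha; exact hBu x
      · have := hmv x a ha
        rw [h, hu] at this
        simpa using this.symm
    · rintro ⟨h, hu, hr⟩
      ext a
      by_cases ha : a = u
      · subst ha; exact hr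
      · rw [hmv x a ha, h, hu]; simp
  have hsurj : LinearMap.range (L.domRestrict K) = ⊤ := by
    rw [LinearMap.range_eq_top]
    rintro ⟨p, q⟩
    have hvne : v ≠ u := hvu.ne
    refine ⟨⟨Pi.single u p + Pi.single v q, ?_⟩, ?_⟩
    · simp only [K, LinearMap.mem_ker, Matrix.mulVecLin_apply, Matrix.mulVec_add]
      ext a
      have h2 : B a v = 0 := by
        rw [hBe, if_neg]
        rintro ⟨h, h', -⟩
        exact h' (huniq a h.symm)
      have h1 : B a u = 0 := by simp [hBe]
      simp [Matrix.mulVec_single, h1, h2]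
    · simp only [LinearMap.domRestrict_apply, hL, Matrix.mulVec_add]
      simp [Matrix.mulVec_single, hAe, hvne.symm, hvu.symm]
  have e1 := LinearMap.finrank_range_add_finrank_ker A.mulVecLin
  have e2 := LinearMap.finrank_range_add_finrank_ker B.mulVecLin
  have e3 := LinearMap.finrank_range_add_finrank_ker (L.domRestrict K)
  have e4 : Module.finrank (ZMod 2) (LinearMap.ker (L.domRestrict K))
      = Module.finrank (ZMod 2) (LinearMap.ker A.mulVecLin) := by
    have h5 : LinearMap.ker (L.domRestrict K) = (K ⊓ LinearMap.ker L).comap K.subtype := by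
      rw [LinearMap.ker_domRestrict]; ext x; simp
    rw [hker, h5]
    exact (Submodule.comapSubtypeEquivOfLe inf_le_left).finrank_eq
  rw [hsurj, finrank_top, e4] at e3
  simp only [Module.finrank_prod, Module.finrank_self] at e3
  change A.rank = B.rank + 2
  change A.rank + _ = _ at e1
  change B.rank + Module.finrank (ZMod 2) K = _ at e2
  omega

theorem rank2_eq_two_mul_vertexCoverNumber_of_acyclic
    {V : Type*} [Fintype V] (G : SimpleGraph V) (hG : G.IsAcyclic) :
    rank2 G = 2 * vertexCoverNumber G := by
  classical
  induction G using WellFoundedLT.induction with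
  | ind G ih =>
    by_cases hne : G = ⊥
    · subst hne
      have h1 : vertexCoverNumber (⊥ : SimpleGraph V) = 0 :=
        Nat.le_zero.mp (Nat.sInf_le ⟨∅, fun _ _ h => h.elim, rfl⟩)
      have h2 : adjMat2 (⊥ : SimpleGraph V) = 0 := by
        ext a b; simp [adjMat2]
      rw [h1, rank2, h2, Matrix.rank_zero]
    · obtain ⟨v, u, hvu, huniq⟩ := exists_leaf G hG hne
      have hle := G.deleteIncidenceSet_le u
      have hlt : G.deleteIncidenceSet u < G := by
        refine lt_of_le_of_ne hle fun h => ?_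
        rw [← h] at hvu
        exact (SimpleGraph.deleteIncidenceSet_adj.mp hvu).2.2 rfl
      rw [rank_step G v u hvu huniq, cover_step G v u hvu huniq, ih _ hlt (hG.anti hle)]
      ring
end

section
/- Let G be a finite simple graph and let v be a vertex of G with two distinct leaf neighbors ℓ₁ and ℓ₂ (both of degree 1 in G and both adjacent to v). Then deleting the leaf ℓ₁ does not change the 𝔽₂-rank of the adjacency matrix: rank₂(G) = rank₂(G − ℓ₁), where G − ℓ₁ is the induced subgraph of G on the vertices other than ℓ₁. -/
/-- Deleting one of two leaf neighbors of a vertex does not change the `𝔽₂`-rank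
of the adjacency matrix. -/
theorem rank2_deleteLeaf_of_two_leaf_neighbors
    {V : Type*} [Fintype V] [DecidableEq V] (G : SimpleGraph V) [DecidableRel G.Adj]
    (v ℓ₁ ℓ₂ : V) (hne : ℓ₁ ≠ ℓ₂)
    (h₁ : G.Adj v ℓ₁) (h₂ : G.Adj v ℓ₂)
    (hd₁ : G.degree ℓ₁ = 1) (hd₂ : G.degree ℓ₂ = 1) :
    rank2 G = rank2 (G.induce {x : V | x ≠ ℓ₁}) := by
  have key : ∀ ℓ, G.Adj v ℓ → G.degree ℓ = 1 → ∀ w, G.Adj ℓ w ↔ w = v := by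
    intro ℓ h hd w
    obtain ⟨a, ha⟩ := Finset.card_eq_one.mp hd
    have hm : ∀ x, G.Adj ℓ x ↔ x = a := fun x => by
      rw [← SimpleGraph.mem_neighborFinset, ha, Finset.mem_singleton]
    have hv := (hm v).1 h.symm
    rw [hm, hv]
  have k₁ := key ℓ₁ h₁ hd₁
  have k₂ := key ℓ₂ h₂ hd₂
  have hv₁ : v ≠ ℓ₁ := h₁.ne
  have hv₂ : v ≠ ℓ₂ := h₂.ne
  let f : V → {x : V | x ≠ ℓ₁} := fun x => if h : x = ℓ₁ then ⟨ℓ₂, hne.symm⟩ else ⟨x, h⟩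
  have hf : ∀ x, (f x : V) = if x = ℓ₁ then ℓ₂ else x := by
    intro x
    by_cases h : x = ℓ₁ <;> simp [f, h]
  have e₁ : adjMat2 G = (adjMat2 (G.induce {x : V | x ≠ ℓ₁})).submatrix f f := by
    ext x y
    have : G.Adj x y ↔ G.Adj (f x) (f y) := by
      rw [hf, hf]
      by_cases hx : x = ℓ₁ <;> by_cases hy : y = ℓ₁
      · simp [hx, hy]
      · simp [hx, hy, k₁, k₂]
      · simp [hx, hy, G.adj_comm x, k₁, k₂]
      · simp [hx, hy]
    simp [adjMat2, this]
  have e₂ : adjMat2 (G.induce {x : V | x ≠ ℓ₁}) =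
      (adjMat2 G).submatrix Subtype.val Subtype.val := by
    ext x y
    simp [adjMat2]
  unfold rank2
  apply le_antisymm
  · rw [e₁]
    exact Matrix.rank_submatrix_le _ _ _
  · rw [e₂]
    exact Matrix.rank_submatrix_le _ _ _
end

section
/- Let T be a finite tree with at least 3 vertices in which every vertex has at most one leaf neighbor. Then T contains a leaf ℓ whose unique neighbor has degree exactly 2 in T. -/
/-- In a tree on at least 3 vertices in which every vertex has at most one leaf
neighbor, some leaf has a neighbor of degree exactly 2. -/
theorem exists_leaf_with_degree_two_neighbor
    {V : Type*} [Fintype V] (T : SimpleGraph V) [DecidableRel T.Adj]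
    (hT : T.IsTree) (hcard : 3 ≤ Fintype.card V)
    (hleaf : ∀ v ℓ₁ ℓ₂ : V, T.Adj v ℓ₁ → T.degree ℓ₁ = 1 →
      T.Adj v ℓ₂ → T.degree ℓ₂ = 1 → ℓ₁ = ℓ₂) :
    ∃ ℓ v : V, T.degree ℓ = 1 ∧ T.Adj ℓ v ∧ T.degree v = 2 := by
  classical
  have hne : Nonempty V := hT.1.nonempty
  obtain ⟨u, v, p, hp, hmax⟩ := SimpleGraph.Walk.exists_isPath_forall_isPath_length_le_length T
  have hlen : 2 ≤ p.length := by
    have hex : ∃ c, 2 ≤ T.degree c := by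
      by_contra! hcon
      have h1 := T.sum_degrees_eq_twice_card_edges
      have h2 := hT.card_edgeFinset
      have h3 : ∑ v, T.degree v ≤ ∑ v : V, 1 :=
        Finset.sum_le_sum fun c _ => by have := hcon c; omega
      simp only [Finset.sum_const, Finset.card_univ, smul_eq_mul, mul_one] at h3
      omega
    obtain ⟨c, hc⟩ := hex
    rw [← SimpleGraph.card_neighborFinset_eq_degree] at hc
    obtain ⟨a, ha, b, hb, hab⟩ := Finset.one_lt_card.1 hc
    rw [SimpleGraph.mem_neighborFinset] at ha hb
    refine hmax a b (.cons ha.symm (.cons hb .nil)) ?_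
    simp [ha.ne', hb.ne, hab]
  -- start of a longest path (of positive length) is a leaf
  have key : ∀ (x y z : V) (h : T.Adj x y) (q : T.Walk y z), (SimpleGraph.Walk.cons h q).IsPath →
      q.length + 1 = p.length → T.degree x = 1 := by
    intro x y z h q hq hl
    rw [← SimpleGraph.card_neighborFinset_eq_degree, Finset.card_eq_one]
    refine ⟨y, ?_⟩
    ext t
    rw [SimpleGraph.mem_neighborFinset, Finset.mem_singleton]
    refine ⟨fun ht => ?_, fun ht => ht ▸ h⟩
    by_cases hs : t ∈ (SimpleGraph.Walk.cons h q).support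
    · simpa using hT.2.eq_snd_of_adj_start hq ht hs
    · have := hmax _ _ _ (hq.cons (h := ht.symm) hs)
      simp at this
      omega
  cases p with
  | nil => simp at hlen
  | @cons _ a _ h q =>
    cases q with
    | nil => simp at hlen
    | @cons _ b _ h' r =>
      have hu := key _ _ _ h _ hp (by simp)
      refine ⟨u, a, hu, h, ?_⟩
      have hq := hp.of_cons
      rw [← SimpleGraph.card_neighborFinset_eq_degree, Finset.card_eq_two]
      refine ⟨u, b, ?_, ?_⟩
      · rintro rfl
        simp at hp
      · ext t
        simp only [SimpleGraph.mem_neighborFinset, Finset.mem_insert, Finset.mem_singleton]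
        constructor
        · intro ht
          by_cases hs : t ∈ (SimpleGraph.Walk.cons h' r).support
          · right
            simpa using hT.2.eq_snd_of_adj_start hq ht hs
          · left
            exact hleaf a t u ht (key _ _ _ ht.symm _ (hq.cons (h := ht.symm) hs) (by simp)) h.symm hu
        · rintro (rfl | rfl)
          · exact h.symm
          · exact h'
end

section
/- Let T be a finite tree, let ℓ be a leaf of T whose unique neighbor v has degree exactly 2 in T, and let T' = T − {v, ℓ} be the induced subgraph of T on the vertices other than v and ℓ. Then the 𝔽₂-rank of the adjacency matrix satisfies rank₂(T) = rank₂(T') + 2. -/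
theorem aux_sum {V K : Type*} [Fintype V] [AddCommMonoid K] (ℓ v : V) (hne : ℓ ≠ v)
    (S : Set V) [Fintype S] (hS : ∀ x, x ∈ S ↔ x ≠ v ∧ x ≠ ℓ) (f : V → K) :
    ∑ x, f x = f v + f ℓ + ∑ x : S, f x := by
  classical
  rw [← Finset.add_sum_erase _ f (Finset.mem_univ v),
    ← Finset.add_sum_erase (Finset.univ.erase v) f (a := ℓ) (by simp [hne]), add_assoc]
  congr 2
  refine Finset.sum_subtype _ (fun x => ?_) f
  simp [hS, and_comm]

theorem aux_rank {V K : Type*} [Fintype V] [DecidableEq V] [Field K] (A : Matrix V V K)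
    (ℓ v : V) (hne : ℓ ≠ v) (S : Set V) [Fintype S] (hS : ∀ x, x ∈ S ↔ x ≠ v ∧ x ≠ ℓ)
    (h1 : ∀ j, A ℓ j = if j = v then 1 else 0) (h2 : ∀ j, A j ℓ = if j = v then 1 else 0) :
    A.rank = (A.submatrix (Subtype.val : S → V) 
      (Subtype.val : S → V)).rank + 2 := by
  set B := A.submatrix (Subtype.val : S → V) 
      (Subtype.val : S → V) with hB
  have hcard : Fintype.card V = Fintype.card S + 2 := by
    have := aux_sum ℓ v hne S hS (fun _ => (1 : ℕ))
    simp only [Finset.sum_const, Finset.card_univ, smul_eq_mul, mul_one] at this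
    omega
  have hv : ∀ x : V → K, (A.mulVec x) ℓ = x v := by
    intro x
    simp [Matrix.mulVec, dotProduct, h1]
  have hrow : ∀ (x : V → K) (i : V), (A.mulVec x) i = A i v * x v + A i ℓ * x ℓ
      + ∑ j : S, A i j * x j := by
    intro x i
    exact aux_sum ℓ v hne S hS (fun j => A i j * x j)
  let F : (V → K) →ₗ[K] (S → K) := LinearMap.funLeft K K Subtype.val
  have hF : ∀ x ∈ LinearMap.ker A.mulVecLin, F x ∈ LinearMap.ker B.mulVecLin := by
    intro x hx
    rw [LinearMap.mem_ker, Matrix.mulVecLin_apply] at hx ⊢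
    have hxv : x v = 0 := by rw [← hv x, hx]; rfl
    funext i
    have := congrFun hx i
    rw [hrow, hxv, h2, if_neg ((hS _).1 i.2).1] at this
    simpa [Matrix.mulVec, dotProduct, hB, F, LinearMap.funLeft] using this
  have hbij : Function.Bijective (F.restrict hF) := by
    constructor
    · rw [injective_iff_map_eq_zero]
      rintro ⟨x, hx⟩ h0
      have h0' : F x = 0 := congrArg Subtype.val h0
      have h0 : ∀ j : S, x j = 0 := fun j => congrFun h0' j
      rw [LinearMap.mem_ker, Matrix.mulVecLin_apply] at hx
      have hxv : x v = 0 := by rw [← hv x, hx]; rfl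
      have hxl := congrFun hx v
      rw [hrow, hxv, h2, if_pos rfl] at hxl
      simp only [h0] at hxl
      ext i
      by_cases hi : i = v
      · subst hi; exact hxv
      by_cases hi' : i = ℓ
      · subst hi'; simpa using hxl
      exact h0 ⟨i, (hS i).2 ⟨hi, hi'⟩⟩
    · rintro ⟨y, hy⟩
      rw [LinearMap.mem_ker, Matrix.mulVecLin_apply] at hy
      let x : V → K := fun i => if h : i ≠ v ∧ i ≠ ℓ then y ⟨i, (hS i).2 h⟩ else
        if i = v then 0 else - ∑ j : S, A v j * y j
      have hxv : x v = 0 := by simp [x]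
      have hxl : x ℓ = - ∑ j : S, A v j * y j := by simp [x, hne]
      have hxj : ∀ j : S, x j = y j := fun j => dif_pos ((hS _).1 j.2)
      refine ⟨⟨x, ?_⟩, Subtype.ext (funext hxj)⟩
      rw [LinearMap.mem_ker, Matrix.mulVecLin_apply]
      funext i
      by_cases hi' : i = ℓ
      · rw [hi', hv, hxv]; rfl
      rw [hrow, hxv, h2]
      simp only [hxj]
      by_cases hi : i = v
      · subst hi; simp [hxl]
      · have := congrFun hy ⟨i, (hS i).2 ⟨hi, hi'⟩⟩
        simpa [hi, Matrix.mulVec, dotProduct, hB] using this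
  have e : Module.finrank K (LinearMap.ker A.mulVecLin) =
      Module.finrank K (LinearMap.ker B.mulVecLin) := (LinearEquiv.ofBijective _ hbij).finrank_eq
  have r1 := LinearMap.finrank_range_add_finrank_ker A.mulVecLin
  have r2 := LinearMap.finrank_range_add_finrank_ker B.mulVecLin
  rw [Module.finrank_fintype_fun_eq_card] at r1 r2
  have r2' : Module.finrank K (LinearMap.range B.mulVecLin) +
      Module.finrank K (LinearMap.ker B.mulVecLin) = Fintype.card S := r2
  change Module.finrank K (LinearMap.range A.mulVecLin) =
    Module.finrank K (LinearMap.range B.mulVecLin) + 2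
  clear r2
  generalize Fintype.card S = c at *
  omega

/-- Removing a leaf `ℓ` together with its degree-two neighbor `v` from a tree
decreases the `𝔽₂`-rank of the adjacency matrix by exactly two. -/
theorem rank2_remove_leaf_and_support
    {V : Type*} [Fintype V] [DecidableEq V] (T : SimpleGraph V) [DecidableRel T.Adj]
    (hT : T.IsTree) (ℓ v : V) (hadj : T.Adj ℓ v)
    (hdegℓ : T.degree ℓ = 1) (hdegv : T.degree v = 2) :
    rank2 T = rank2 (T.induce {x : V | x ≠ v ∧ x ≠ ℓ}) + 2 := by
  have hne : ℓ ≠ v := hadj.ne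
  have hu : ∀ j, T.Adj ℓ j ↔ j = v := by
    rw [← SimpleGraph.card_neighborFinset_eq_degree, Finset.card_eq_one] at hdegℓ
    obtain ⟨a, ha⟩ := hdegℓ
    have key : ∀ j, T.Adj ℓ j ↔ j = a := by
      intro j
      rw [← SimpleGraph.mem_neighborFinset, ha, Finset.mem_singleton]
    have := (key v).1 hadj
    subst this
    exact key
  unfold rank2
  rw [aux_rank (adjMat2 T) ℓ v hne {x : V | x ≠ v ∧ x ≠ ℓ} (fun _ => Iff.rfl) (fun j => by simp [adjMat2, hu])
    (fun j => by simp [adjMat2, T.adj_comm j ℓ, hu])]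
  rfl
end

section
/- Let C be a chord diagram, and let S and S' be two distinct segments of C. If there exist chords c ∈ S and c' ∈ S' such that c and c' cross, then every chord of S crosses every chord of S'; that is, for all c ∈ S and c' ∈ S', the chords c and c' cross. -/
/-- A chord is a pair `(ℓ, r)` of natural numbers; in a chord diagram `ℓ < r`. -/
abbrev Chord := ℕ × ℕ

/-- Chords `c₁ = (ℓ₁, r₁)` and `c₂ = (ℓ₂, r₂)` cross if `ℓ₁ < ℓ₂ < r₁ < r₂`
or `ℓ₂ < ℓ₁ < r₂ < r₁`. -/
def Crosses (c₁ c₂ : Chord) : Prop :=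
  (c₁.1 < c₂.1 ∧ c₂.1 < c₁.2 ∧ c₁.2 < c₂.2) ∨
  (c₂.1 < c₁.1 ∧ c₁.1 < c₂.2 ∧ c₂.2 < c₁.2)

/-- The chord `c₂` is nested in `c₁` if `ℓ₁ < ℓ₂ < r₂ < r₁`. -/
def NestedIn (c₂ c₁ : Chord) : Prop :=
  c₁.1 < c₂.1 ∧ c₂.1 < c₂.2 ∧ c₂.2 < c₁.2

/-- A chord diagram: a finite set of chords `(ℓ, r)` with `ℓ < r` whose
endpoints are pairwise distinct. -/
def IsChordDiagram (C : Finset Chord) : Prop :=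
  (∀ c ∈ C, c.1 < c.2) ∧
  ∀ c ∈ C, ∀ c' ∈ C, c ≠ c' →
    c.1 ≠ c'.1 ∧ c.1 ≠ c'.2 ∧ c.2 ≠ c'.1 ∧ c.2 ≠ c'.2

/-- `x` lies strictly between `a` and `b`. -/
def Between (a x b : ℕ) : Prop := min a b < x ∧ x < max a b

/-- Chords `c₁` and `c₂` are chord obstructed in `C` if some other chord of `C`
has an endpoint strictly between their left endpoints or strictly between their
right endpoints. -/
def ChordObstructed (C : Finset Chord) (c₁ c₂ : Chord) : Prop :=
  ∃ c'' ∈ C, c'' ≠ c₁ ∧ c'' ≠ c₂ ∧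
    (Between c₁.1 c''.1 c₂.1 ∨ Between c₁.1 c''.2 c₂.1 ∨
     Between c₁.2 c''.1 c₂.2 ∨ Between c₁.2 c''.2 c₂.2)

/-- A list of chords `c₁, …, c_k` forms a `k`-nesting:
`ℓ₁ < ⋯ < ℓ_k < r_k < ⋯ < r₁`, i.e. each later chord is nested in each earlier one. -/
def IsNestingList (L : List Chord) : Prop :=
  L.Pairwise fun c c' => NestedIn c' c

/-- `S` is the chord set of a (k-)nesting listed in nesting order in which
consecutive chords are not chord obstructed. -/
def SegWitness (C S : Finset Chord) : Prop :=
  ∃ L : List Chord, L.Nodup ∧ L.toFinset = S ∧ IsNestingList L ∧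
    L.Chain' fun c c' => ¬ ChordObstructed C c c'

/-- A segment of `C`: a maximal nonempty subset of `C` forming a nesting with
consecutive chords not chord obstructed. -/
def IsSegment (C S : Finset Chord) : Prop :=
  S.Nonempty ∧ S ⊆ C ∧ SegWitness C S ∧
    ∀ S' : Finset Chord, S' ⊆ C → S ⊆ S' → SegWitness C S' → S' = S

theorem cross_step (C : Finset Chord) (hC : IsChordDiagram C) (a b d : Chord)
    (ha : a ∈ C) (hb : b ∈ C) (hd : d ∈ C) (hn : NestedIn b a)
    (ho : ¬ ChordObstructed C a b) : Crosses a d ↔ Crosses b d := by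
  have h1 := hC.1 a ha
  have h2 := hC.1 b hb
  have h3 := hC.1 d hd
  unfold NestedIn at hn
  by_cases hda : d = a
  · subst hda
    unfold Crosses
    omega
  by_cases hdb : d = b
  · subst hdb
    unfold Crosses
    omega
  have e1 := hC.2 d hd a ha hda
  have e2 := hC.2 d hd b hb hdb
  have hk : ¬ (Between a.1 d.1 b.1 ∨ Between a.1 d.2 b.1 ∨
     Between a.2 d.1 b.2 ∨ Between a.2 d.2 b.2) := fun h => ho ⟨d, hd, hda, hdb, h⟩
  unfold Between at hk
  unfold Crosses
  omega

theorem cross_list (C : Finset Chord) (hC : IsChordDiagram C) (d : Chord) (hd : d ∈ C) :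
    ∀ (L : List Chord) (a : Chord), (∀ x ∈ a :: L, x ∈ C) → IsNestingList (a :: L) →
    (a :: L).IsChain (fun c c' => ¬ ChordObstructed C c c') →
    ∀ x ∈ a :: L, (Crosses a d ↔ Crosses x d) := by
  intro L
  induction L with
  | nil =>
    intro a _ _ _ x hx
    rw [List.mem_singleton.1 hx]
  | cons b L ih =>
    intro a hm hn hc x hx
    unfold IsNestingList at hn
    rcases List.mem_cons.1 hx with rfl | hx
    · rfl
    have hn' := List.pairwise_cons.1 hn
    have hc' := List.isChain_cons_cons.1 hc
    have s := cross_step C hC a b d (hm a (by simp)) (hm b (by simp)) hd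
      (hn'.1 b (by simp)) hc'.1
    exact s.trans (ih b (fun y hy => hm y (List.mem_cons_of_mem _ hy)) hn'.2 hc'.2 x hx)

theorem cross_seg (C : Finset Chord) (hC : IsChordDiagram C) (S : Finset Chord)
    (hS : IsSegment C S) (d : Chord) (hd : d ∈ C) (x y : Chord) (hx : x ∈ S) (hy : y ∈ S)
    (h : Crosses x d) : Crosses y d := by
  obtain ⟨_, hsub, ⟨L, _, rfl, hn, hc⟩, _⟩ := hS
  rw [List.mem_toFinset] at hx hy
  cases L with
  | nil => simp at hx
  | cons a L =>
    have key := cross_list C hC d hd L a (fun z hz => hsub (List.mem_toFinset.2 hz)) hn hc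
    exact (key y hy).1 ((key x hx).2 h)

theorem cross_symm (a b : Chord) (h : Crosses a b) : Crosses b a := Or.symm h

/-- If some chord of a segment `S` crosses some chord of another segment `S'`,
then every chord of `S` crosses every chord of `S'`. -/
theorem segment_crossing_all (C : Finset Chord) (hC : IsChordDiagram C)
    (S S' : Finset Chord) (hS : IsSegment C S) (hS' : IsSegment C S')
    (hne : S ≠ S')
    (hx : ∃ c ∈ S, ∃ c' ∈ S', Crosses c c') :
    ∀ c ∈ S, ∀ c' ∈ S', Crosses c c' := by
  obtain ⟨a, ha, a', ha', h⟩ := hx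
  intro c hc c' hc'
  have h1 := cross_seg C hC S hS a' (hS'.2.1 ha') a c ha hc h
  exact cross_symm _ _ (cross_seg C hC S' hS' c (hS.2.1 hc) a' c' ha' hc' (cross_symm _ _ h1))
end

section
/- Fix a natural number τ ≥ 1. Let C be a chord diagram, and let S₁ and S₂ be two distinct τ-segments of C. If there exist chords c ∈ S₁ and c' ∈ S₂ such that c and c' cross, then every chord of S₁ crosses every chord of S₂; that is, for all c ∈ S₁ and c' ∈ S₂, the chords c and c' cross. -/
/-- A list of chords `c₁, …, c_k` forms a `k`-crossing:
`ℓ₁ < ⋯ < ℓ_k < r₁ < ⋯ < r_k`. -/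
def IsCrossingList (L : List Chord) : Prop :=
  (L.Pairwise fun c c' => c.1 < c'.1 ∧ c.2 < c'.2) ∧
    ∀ c ∈ L, ∀ c' ∈ L, c.1 < c'.2

/-- The chord distance `d(c₁, c₂) = max(|ℓ₁ − ℓ₂|, |r₁ − r₂|)`. -/
def chordDist (c₁ c₂ : Chord) : ℕ :=
  max (Nat.dist c₁.1 c₂.1) (Nat.dist c₁.2 c₂.2)

/-- Chords are `τ`-near if their chord distance is at most `τ` and they are not
chord obstructed. -/
def TauNear (C : Finset Chord) (τ : ℕ) (c₁ c₂ : Chord) : Prop :=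
  chordDist c₁ c₂ ≤ τ ∧ ¬ ChordObstructed C c₁ c₂

/-- `S` is the chord set of a nesting or crossing, listed in order, in which
consecutive chords are `τ`-near. -/
def TauSegWitness (C : Finset Chord) (τ : ℕ) (S : Finset Chord) : Prop :=
  ∃ L : List Chord, L.Nodup ∧ L.toFinset = S ∧
    (IsNestingList L ∨ IsCrossingList L) ∧ L.Chain' (TauNear C τ)

/-- A `τ`-segment of `C`: a maximal nonempty subset of `C` forming a `τ`-near
nesting or a `τ`-near crossing. -/
def IsTauSegment (C : Finset Chord) (τ : ℕ) (S : Finset Chord) : Prop :=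
  S.Nonempty ∧ S ⊆ C ∧ TauSegWitness C τ S ∧
    ∀ S' : Finset Chord, S' ⊆ C → S ⊆ S' → TauSegWitness C τ S' → S' = S

def NR (C : Finset Chord) (τ : ℕ) (a b : Chord) : Prop :=
  a ∈ C ∧ b ∈ C ∧ NestedIn b a ∧ TauNear C τ a b

def XR (C : Finset Chord) (τ : ℕ) (a b : Chord) : Prop :=
  a ∈ C ∧ b ∈ C ∧ (a.1 < b.1 ∧ b.1 < a.2 ∧ a.2 < b.2) ∧ TauNear C τ a b

lemma no_between {C : Finset Chord} {τ : ℕ} {a b x : Chord} (h : TauNear C τ a b)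
    (hx : x ∈ C) (hxa : x ≠ a) (hxb : x ≠ b) :
    ¬ Between a.1 x.1 b.1 ∧ ¬ Between a.1 x.2 b.1 ∧ ¬ Between a.2 x.1 b.2 ∧
      ¬ Between a.2 x.2 b.2 := by
  have := h.2
  unfold ChordObstructed at this
  push Not at this
  exact this x hx hxa hxb

lemma NR_inj {C : Finset Chord} (hC : IsChordDiagram C) {τ : ℕ} {a a' b : Chord}
    (h : NR C τ a b) (h' : NR C τ a' b) : a = a' := by
  by_contra hne
  obtain ⟨ha, hb, ⟨n1, n2, n3⟩, t⟩ := h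
  obtain ⟨ha', -, ⟨m1, m2, m3⟩, t'⟩ := h'
  have e := hC.2 a ha a' ha' hne
  have k1 := no_between t ha' (Ne.symm hne) (by rintro rfl; omega)
  have k2 := no_between t' ha hne (by rintro rfl; omega)
  simp only [Between] at k1 k2
  omega

lemma NR_fun {C : Finset Chord} (hC : IsChordDiagram C) {τ : ℕ} {a b b' : Chord}
    (h : NR C τ a b) (h' : NR C τ a b') : b = b' := by
  by_contra hne
  obtain ⟨ha, hb, ⟨n1, n2, n3⟩, t⟩ := h
  obtain ⟨-, hb', ⟨m1, m2, m3⟩, t'⟩ := h'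
  have e := hC.2 b hb b' hb' hne
  have k1 := no_between t hb' (by rintro rfl; omega) (Ne.symm hne)
  have k2 := no_between t' hb (by rintro rfl; omega) hne
  simp only [Between] at k1 k2
  omega

lemma XR_inj {C : Finset Chord} (hC : IsChordDiagram C) {τ : ℕ} {a a' b : Chord}
    (h : XR C τ a b) (h' : XR C τ a' b) : a = a' := by
  by_contra hne
  obtain ⟨ha, hb, ⟨n1, n2, n3⟩, t⟩ := h
  obtain ⟨ha', -, ⟨m1, m2, m3⟩, t'⟩ := h'
  have e := hC.2 a ha a' ha' hne
  have k1 := no_between t ha' (Ne.symm hne) (by rintro rfl; omega)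
  have k2 := no_between t' ha hne (by rintro rfl; omega)
  simp only [Between] at k1 k2
  omega

lemma XR_fun {C : Finset Chord} (hC : IsChordDiagram C) {τ : ℕ} {a b b' : Chord}
    (h : XR C τ a b) (h' : XR C τ a b') : b = b' := by
  by_contra hne
  obtain ⟨ha, hb, ⟨n1, n2, n3⟩, t⟩ := h
  obtain ⟨-, hb', ⟨m1, m2, m3⟩, t'⟩ := h'
  have e := hC.2 b hb b' hb' hne
  have k1 := no_between t hb' (by rintro rfl; omega) (Ne.symm hne)
  have k2 := no_between t' hb (by rintro rfl; omega) hne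
  simp only [Between] at k1 k2
  omega

lemma NX_mix {C : Finset Chord} (hC : IsChordDiagram C) {τ : ℕ} {a b c : Chord}
    (h : NR C τ a b ∨ NR C τ b a) (h' : XR C τ c b ∨ XR C τ b c) : False := by
  have hac : a ≠ c := by
    rintro rfl
    rcases h with ⟨-, -, ⟨n1, n2, n3⟩, -⟩ | ⟨-, -, ⟨n1, n2, n3⟩, -⟩ <;>
    rcases h' with ⟨-, -, ⟨m1, m2, m3⟩, -⟩ | ⟨-, -, ⟨m1, m2, m3⟩, -⟩ <;> omega
  rcases h with ⟨ha, hb, ⟨n1, n2, n3⟩, t⟩ | ⟨hb, ha, ⟨n1, n2, n3⟩, t⟩ <;>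
  rcases h' with ⟨hc, -, ⟨m1, m2, m3⟩, t'⟩ | ⟨-, hc, ⟨m1, m2, m3⟩, t'⟩ <;>
  · have e := hC.2 a ha c hc hac
    have hab : a ≠ b := by rintro rfl; omega
    have hcb : c ≠ b := by rintro rfl; omega
    have k1 := no_between t hc (by first | exact hac.symm | exact hcb)
      (by first | exact hac.symm | exact hcb)
    have k2 := no_between t' ha (by first | exact hac | exact hab)
      (by first | exact hac | exact hab)
    simp only [Between] at k1 k2
    omega

lemma prop_chain {R : Chord → Chord → Prop} {P : Chord → Prop} :
    ∀ {L : List Chord}, L.IsChain R →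
      (∀ a ∈ L, ∀ b ∈ L, R a b → (P a ↔ P b)) → ∀ x ∈ L, ∀ y ∈ L, (P x ↔ P y)
  | [], _, _, x, hx, _, _ => by simp at hx
  | [a], _, _, x, hx, y, hy => by
      simp only [List.mem_singleton] at hx hy; rw [hx, hy]
  | a :: b :: L, h, hP, x, hx, y, hy => by
      rw [List.isChain_cons_cons] at h
      have ih := prop_chain h.2 (fun a ha b hb => hP a (List.mem_cons_of_mem _ ha) b
        (List.mem_cons_of_mem _ hb))
      have hab := hP a (by simp) b (by simp) h.1
      have key : ∀ z ∈ a :: b :: L, (P z ↔ P b) := by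
        intro z hz
        rcases List.mem_cons.1 hz with rfl | hz
        · exact hab
        · exact ih z hz b (by simp)
      rw [key x hx, key y hy]

lemma chain_pw {R T U : Chord → Chord → Prop} {C : Finset Chord}
    (H : ∀ a ∈ C, ∀ b ∈ C, R a b → T a b → U a b) :
    ∀ {L : List Chord}, (∀ c ∈ L, c ∈ C) → L.IsChain R → L.IsChain T → L.IsChain U
  | [], _, _, _ => by simp
  | [a], _, _, _ => by simp
  | a :: b :: L, hL, h, h' => by
      rw [List.isChain_cons_cons] at *
      exact ⟨H a (hL a (by simp)) b (hL b (by simp)) h.1 h'.1,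
        chain_pw H (fun c hc => hL c (List.mem_cons_of_mem _ hc)) h.2 h'.2⟩

lemma NR_wit {C : Finset Chord} {τ : ℕ} {L : List Chord}
    (h : L.IsChain (NR C τ)) : TauSegWitness C τ L.toFinset := by
  have hp : L.Pairwise fun c c' => NestedIn c' c := by
    have : IsTrans Chord (fun c c' => NestedIn c' c) :=
      ⟨fun a b c h1 h2 => by simp only [NestedIn] at *; omega⟩
    exact List.isChain_iff_pairwise.1 (h.imp fun a b h => h.2.2.1)
  refine ⟨L, hp.imp ?_, rfl, Or.inl hp, h.imp fun a b h => h.2.2.2⟩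
  rintro a b h rfl
  simp only [NestedIn] at h; omega

lemma XR_aux {C : Finset Chord} (hC : IsChordDiagram C) {τ : ℕ} {x : Chord} (hx : x ∈ C) :
    ∀ {L : List Chord} {a : Chord}, (a :: L).IsChain (XR C τ) → a.1 < x.2 →
      ∀ c ∈ a :: L, c.1 < x.2
  | [], a, _, h, c, hc => by simp only [List.mem_singleton] at hc; rwa [hc]
  | b :: L, a, h, hax, c, hc => by
      rw [List.isChain_cons_cons] at h
      have hb : b.1 < x.2 := by
        obtain ⟨ha, hb, m, t⟩ := h.1
        by_cases h1 : x = a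
        · subst h1; omega
        by_cases h2 : x = b
        · subst h2; exact hC.1 _ hx
        have k := no_between t hx h1 h2
        have e := hC.2 x hx b hb h2
        simp only [Between] at k
        omega
      rcases List.mem_cons.1 hc with rfl | hc
      · exact hax
      · exact XR_aux hC hx h.2 hb c hc

lemma XR_wit {C : Finset Chord} (hC : IsChordDiagram C) {τ : ℕ} {L : List Chord}
    (hL : ∀ c ∈ L, c ∈ C)
    (h : L.IsChain (XR C τ)) : TauSegWitness C τ L.toFinset := by
  have hp : L.Pairwise fun c c' : Chord => c.1 < c'.1 ∧ c.2 < c'.2 := by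
    have : IsTrans Chord (fun c c' : Chord => c.1 < c'.1 ∧ c.2 < c'.2) :=
      ⟨fun a b c h1 h2 => by omega⟩
    exact List.isChain_iff_pairwise.1 (h.imp fun a b h => ⟨h.2.2.1.1, h.2.2.1.2.2⟩)
  refine ⟨L, hp.imp ?_, rfl, Or.inr ⟨hp, ?_⟩, h.imp fun a b h => h.2.2.2⟩
  · rintro a b h rfl
    omega
  · intro c hc c' hc'
    cases L with
    | nil => simp at hc
    | cons a L =>
      refine XR_aux hC (hL c' hc') h ?_ c hc
      have := hC.1 c' (hL c' hc')
      rcases List.mem_cons.1 hc' with rfl | hm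
      · exact this
      · have := (List.pairwise_cons.1 hp).1 c' hm
        omega

lemma wit_chain {C : Finset Chord} {τ : ℕ} {S : Finset Chord} (hS : S ⊆ C)
    (h : TauSegWitness C τ S) : ∃ L : List Chord, L.toFinset = S ∧ L.IsChain (TauNear C τ) ∧
      (L.IsChain (NR C τ) ∨ L.IsChain (XR C τ)) := by
  obtain ⟨L, -, hLS, hL, hch⟩ := h
  have hm : ∀ c ∈ L, c ∈ C := fun c hc => hS (by rw [← hLS]; simpa using hc)
  refine ⟨L, hLS, hch, ?_⟩
  rcases hL with hL | ⟨hL, hL2⟩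
  · left
    exact chain_pw (fun a ha b hb h1 h2 => ⟨ha, hb, h1, h2⟩) hm (List.Pairwise.isChain hL) hch
  · right
    have hp : L.Pairwise fun c c' : Chord => c.1 < c'.1 ∧ c'.1 < c.2 ∧ c.2 < c'.2 :=
      hL.imp_of_mem fun {a b} ha hb h => ⟨h.1, hL2 b hb a ha, h.2⟩
    exact chain_pw (fun a ha b hb h1 h2 => ⟨ha, hb, h1, h2⟩) hm hp.isChain hch

lemma seg_closed {C : Finset Chord} {τ : ℕ} {R : Chord → Chord → Prop} {S : Finset Chord}
    (hinj : ∀ a a' b, R a b → R a' b → a = a') (hfun : ∀ a b b', R a b → R a b' → b = b')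
    (hRC : ∀ a b, R a b → a ∈ C ∧ b ∈ C)
    (hw : ∀ L : List Chord, (∀ c ∈ L, c ∈ C) → L.IsChain R → TauSegWitness C τ L.toFinset)
    (hS : IsTauSegment C τ S) {L : List Chord} (hL : L.toFinset = S) (hch : L.IsChain R)
    (a b : Chord) (hab : R a b) : a ∈ S ↔ b ∈ S := by
  obtain ⟨-, hSC, -, hmax⟩ := hS
  have hm : ∀ c ∈ L, c ∈ C := fun c hc => hSC (by rw [← hL]; simpa using hc)
  obtain ⟨haC, hbC⟩ := hRC a b hab
  constructor
  · intro ha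
    obtain ⟨p, s, rfl⟩ := List.append_of_mem (show a ∈ L by rw [← hL] at ha; simpa using ha)
    cases s with
    | nil =>
      have hc : (p ++ [a] ++ [b]).IsChain R := by
        rw [List.isChain_append]
        exact ⟨hch, by simp, by simpa using hab⟩
      have hm' : ∀ c ∈ p ++ [a] ++ [b], c ∈ C := by
        intro c hc
        rcases List.mem_append.1 hc with hc | hc
        · exact hm c hc
        · simp only [List.mem_singleton] at hc; rwa [hc]
      have := hmax _ (fun c hc => hm' c (List.mem_toFinset.1 hc))
        (by rw [← hL]; intro c hc; simp at hc ⊢; tauto) (hw _ hm' hc)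
      rw [← this]; simp
    | cons d t =>
      have hd : R a d := by
        rw [List.isChain_append, List.isChain_cons_cons] at hch
        exact hch.2.1.1
      rw [hfun a b d hab hd, ← hL]; simp
  · intro hb
    obtain ⟨p, s, rfl⟩ := List.append_of_mem (show b ∈ L by rw [← hL] at hb; simpa using hb)
    rcases List.eq_nil_or_concat p with rfl | ⟨q, d, rfl⟩
    · have hc : (a :: b :: s).IsChain R := List.isChain_cons_cons.2 ⟨hab, hch⟩
      have hm' : ∀ c ∈ a :: b :: s, c ∈ C := by
        intro c hc
        rcases List.mem_cons.1 hc with rfl | hc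
        · exact haC
        · exact hm c hc
      have := hmax _ (fun c hc => hm' c (List.mem_toFinset.1 hc))
        (by rw [← hL]; intro c hc; simp at hc ⊢; tauto) (hw _ hm' hc)
      rw [← this]; simp
    · have hd : R d b := by
        rw [List.isChain_append] at hch
        exact hch.2.2 d (by simp) b (by simp)
      rw [hinj a d b hab hd, ← hL]; simp

lemma seg_eq {C : Finset Chord} {τ : ℕ} {R : Chord → Chord → Prop} {S S' : Finset Chord}
    (hinj : ∀ a a' b, R a b → R a' b → a = a') (hfun : ∀ a b b', R a b → R a b' → b = b')
    (hRC : ∀ a b, R a b → a ∈ C ∧ b ∈ C)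
    (hw : ∀ L : List Chord, (∀ c ∈ L, c ∈ C) → L.IsChain R → TauSegWitness C τ L.toFinset)
    (hS : IsTauSegment C τ S) {L : List Chord} (hL : L.toFinset = S) (hch : L.IsChain R)
    (hS' : IsTauSegment C τ S') {L' : List Chord} (hL' : L'.toFinset = S') (hch' : L'.IsChain R)
    {b : Chord} (hb : b ∈ S) (hb' : b ∈ S') : S = S' := by
  refine hS'.2.2.2 S hS.2.1 ?_ hS.2.2.1
  intro c hc
  rw [← hL'] at hc hb'
  exact (prop_chain (P := fun x => x ∈ S) hch'
    (fun x _ y _ h => seg_closed hinj hfun hRC hw hS hL hch x y h) b (by simpa using hb') c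
    (by simpa using hc)).1 hb

lemma nbr {R : Chord → Chord → Prop} {L : List Chord} (h : L.IsChain R) {b : Chord}
    (hb : b ∈ L) : L = [b] ∨ ∃ a, R a b ∨ R b a := by
  obtain ⟨p, s, rfl⟩ := List.append_of_mem hb
  cases s with
  | cons d t =>
    rw [List.isChain_append, List.isChain_cons_cons] at h
    exact Or.inr ⟨d, Or.inr h.2.1.1⟩
  | nil =>
    rcases List.eq_nil_or_concat p with rfl | ⟨q, d, rfl⟩
    · left; simp
    · rw [List.isChain_append] at h
      exact Or.inr ⟨d, Or.inl (h.2.2 d (by simp) b (by simp))⟩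

lemma seg_disj {C : Finset Chord} (hC : IsChordDiagram C) {τ : ℕ} {S S' : Finset Chord}
    (hS : IsTauSegment C τ S) (hS' : IsTauSegment C τ S')
    {b : Chord} (hb : b ∈ S) (hb' : b ∈ S') : S = S' := by
  obtain ⟨L, hL, -, h⟩ := wit_chain hS.2.1 hS.2.2.1
  obtain ⟨L', hL', -, h'⟩ := wit_chain hS'.2.1 hS'.2.2.1
  have bL : b ∈ L := by rw [← hL] at hb; simpa using hb
  have bL' : b ∈ L' := by rw [← hL'] at hb'; simpa using hb'
  have e1 : L = [b] → S = S' := by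
    rintro rfl
    exact (hS.2.2.2 S' hS'.2.1 (by rw [← hL]; simpa using hb') hS'.2.2.1).symm
  have e2 : L' = [b] → S = S' := by
    rintro rfl
    exact hS'.2.2.2 S hS.2.1 (by rw [← hL']; simpa using hb) hS.2.2.1
  rcases h with h | h <;> rcases h' with h' | h'
  · exact seg_eq (R := NR C τ) (fun _ _ _ => NR_inj hC) (fun _ _ _ => NR_fun hC)
      (fun _ _ h => ⟨h.1, h.2.1⟩) (fun _ _ h => NR_wit h) hS hL h hS' hL' h' hb hb'
  · rcases nbr h bL with k | ⟨a, k⟩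
    · exact e1 k
    rcases nbr h' bL' with k' | ⟨a', k'⟩
    · exact e2 k'
    exact (NX_mix hC k k').elim
  · rcases nbr h bL with k | ⟨a, k⟩
    · exact e1 k
    rcases nbr h' bL' with k' | ⟨a', k'⟩
    · exact e2 k'
    exact (NX_mix hC k' k).elim
  · exact seg_eq (R := XR C τ) (fun _ _ _ => XR_inj hC) (fun _ _ _ => XR_fun hC)
      (fun _ _ h => ⟨h.1, h.2.1⟩) (fun _ h1 h => XR_wit hC h1 h) hS hL h hS' hL' h' hb hb'

lemma cross_near {C : Finset Chord} (hC : IsChordDiagram C) {τ : ℕ} {a b x : Chord}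
    (ha : a ∈ C) (hb : b ∈ C) (hx : x ∈ C) (hxa : x ≠ a) (hxb : x ≠ b)
    (h : TauNear C τ a b) : Crosses a x ↔ Crosses b x := by
  have k := no_between h hx hxa hxb
  have e1 := hC.2 x hx a ha hxa
  have e2 := hC.2 x hx b hb hxb
  have := hC.1 x hx
  have := hC.1 a ha
  have := hC.1 b hb
  simp only [Between] at k
  unfold Crosses
  omega

lemma cross_seg_s13 {C : Finset Chord} (hC : IsChordDiagram C) {τ : ℕ} {S : Finset Chord}
    (hS : IsTauSegment C τ S) {x : Chord} (hx : x ∈ C) (hxS : x ∉ S) {a b : Chord}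
    (ha : a ∈ S) (hb : b ∈ S) (h : Crosses a x) : Crosses b x := by
  obtain ⟨L, hL, hch, -⟩ := wit_chain hS.2.1 hS.2.2.1
  have hm : ∀ c, c ∈ L ↔ c ∈ S := fun c => by rw [← hL]; simp
  refine (prop_chain (P := fun c => Crosses c x) hch ?_ a ((hm a).2 ha) b ((hm b).2 hb)).1 h
  intro c hc d hd hn
  rw [hm] at hc hd
  exact cross_near hC (hS.2.1 hc) (hS.2.1 hd) hx (by rintro rfl; exact hxS hc)
    (by rintro rfl; exact hxS hd) hn

/-- If some chord of a `τ`-segment `S₁` crosses some chord of another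
`τ`-segment `S₂`, then every chord of `S₁` crosses every chord of `S₂`. -/
theorem tauSegment_crossing_all (τ : ℕ) (hτ : 1 ≤ τ)
    (C : Finset Chord) (hC : IsChordDiagram C)
    (S₁ S₂ : Finset Chord) (hS₁ : IsTauSegment C τ S₁) (hS₂ : IsTauSegment C τ S₂)
    (hne : S₁ ≠ S₂)
    (hx : ∃ c ∈ S₁, ∃ c' ∈ S₂, Crosses c c') :
    ∀ c ∈ S₁, ∀ c' ∈ S₂, Crosses c c' := by
  obtain ⟨a, ha, b, hb, h⟩ := hx
  intro c hc d hd
  have h1 : Crosses c b := cross_seg_s13 hC hS₁ (hS₂.2.1 hb)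
    (fun hm => hne (seg_disj hC hS₁ hS₂ hm hb)) ha hc h
  have h2 : Crosses d c := cross_seg_s13 hC hS₂ (hS₁.2.1 hc)
    (fun hm => hne (seg_disj hC hS₁ hS₂ hc hm)) hb hd (Or.symm h1)
  exact Or.symm h2
end

section
/- Let C be a chord diagram and let c₁ = (ℓ₁, r₁) and c₂ = (ℓ₂, r₂) be chords of C such that c₂ is nested in c₁ and c₁, c₂ are not chord obstructed. Then for every chord c ∈ C with c ≠ c₁ and c ≠ c₂, the chord c crosses c₁ if and only if c crosses c₂. -/
/-- If `c₂` is nested in `c₁` and they are not chord obstructed, then any other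
chord of the diagram crosses `c₁` if and only if it crosses `c₂`. -/
theorem crosses_iff_of_nested_unobstructed
    (C : Finset Chord) (hC : IsChordDiagram C) (c₁ c₂ : Chord)
    (h₁ : c₁ ∈ C) (h₂ : c₂ ∈ C) (hnest : NestedIn c₂ c₁)
    (hobs : ¬ ChordObstructed C c₁ c₂) :
    ∀ c ∈ C, c ≠ c₁ → c ≠ c₂ → (Crosses c c₁ ↔ Crosses c c₂) := by
  intro c hc hc1 hc2
  have d1 := hC.2 c hc c₁ h₁ hc1
  have d2 := hC.2 c hc c₂ h₂ hc2
  have hlt := hC.1 c hc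
  have ho : ¬ (Between c₁.1 c.1 c₂.1 ∨ Between c₁.1 c.2 c₂.1 ∨
      Between c₁.2 c.1 c₂.2 ∨ Between c₁.2 c.2 c₂.2) :=
    fun h => hobs ⟨c, hc, hc1, hc2, h⟩
  unfold Between at ho
  unfold NestedIn at hnest
  unfold Crosses
  omega
end
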